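/- arXiv:1803.10871 — 9 statements merged into one kernel-verified Lean document; each statement's English description precedes it below -/
import Mathlib

section
/- Let T, p, q be positive natural numbers. Let X be a T×p real matrix with XᵀX invertible and set M = I_T − X(XᵀX)⁻¹Xᵀ. Let Z₀ and Z₂ be T×q real matrices such that Z₀ᵀMZ₀ and Z₂ᵀMZ₂ are invertible. Let δ ∈ ℝ^q, β ∈ ℝ^p, e ∈ ℝ^T, and define Y = Xβ + Z₀δ + e, δ̂₂ = (Z₂ᵀMZ₂)⁻¹Z₂ᵀMY and δ̂₀ = (Z₀ᵀMZ₀)⁻¹Z₀ᵀMY. Then δ̂₂ᵀ(Z₂ᵀMZ₂)δ̂₂ − δ̂₀ᵀ(Z₀ᵀMZ₀)δ̂₀ = g_d + g_e, where g_d = δᵀ(Z₀ᵀMZ₂)(Z₂ᵀMZ₂)⁻¹(Z₂ᵀMZ₀)δ − δᵀ(Z₀ᵀMZ₀)δ and g_e = 2δᵀ(Z₀ᵀMZ₂)(Z₂ᵀMZ₂)⁻¹Z₂ᵀMe − 2δᵀZ₀ᵀMe + eᵀMZ₂(Z₂ᵀMZ₂)⁻¹Z₂ᵀMe − eᵀMZ₀(Z₀ᵀMZ₀)⁻¹Z₀ᵀMe.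 -/
open Matrix

lemma one_by_one_transpose (A : Matrix (Fin 1) (Fin 1) ℝ) : Aᵀ = A := by
  ext i j
  rw [Subsingleton.elim i j]
  rfl

lemma criterion_expand {T q : ℕ} (M : Matrix (Fin T) (Fin T) ℝ) (hMt : Mᵀ = M)
    (Z : Matrix (Fin T) (Fin q) ℝ) (hZ : IsUnit (Zᵀ * M * Z))
    (u e Y : Matrix (Fin T) (Fin 1) ℝ) (hY : M * Y = M * (u + e))
    (d : Matrix (Fin q) (Fin 1) ℝ) (hd : d = (Zᵀ * M * Z)⁻¹ * (Zᵀ * M * Y)) :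
    dᵀ * (Zᵀ * M * Z) * d =
      uᵀ * (M * Z * (Zᵀ * M * Z)⁻¹ * (Zᵀ * M)) * u
      + (2 : ℝ) • (uᵀ * (M * Z * (Zᵀ * M * Z)⁻¹ * (Zᵀ * M)) * e)
      + eᵀ * (M * Z * (Zᵀ * M * Z)⁻¹ * (Zᵀ * M)) * e := by
  have hdet := (Matrix.isUnit_iff_isUnit_det _).1 hZ
  have hAt : (Zᵀ * M * Z)ᵀ = Zᵀ * M * Z := by
    simp [Matrix.transpose_mul, hMt, Matrix.mul_assoc]
  have hd' : d = (Zᵀ * M * Z)⁻¹ * (Zᵀ * M * (u + e)) := by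
    rw [hd, Matrix.mul_assoc Zᵀ M Y, hY, Matrix.mul_assoc Zᵀ M (u + e)]
  have hAd : (Zᵀ * M * Z) * d = Zᵀ * M * (u + e) := by
    rw [hd', Matrix.mul_nonsing_inv_cancel_left _ _ hdet]
  have hdt : dᵀ = (u + e)ᵀ * (M * Z * (Zᵀ * M * Z)⁻¹) := by
    rw [hd', Matrix.transpose_mul, Matrix.transpose_nonsing_inv, hAt]
    simp only [Matrix.transpose_mul, hMt, Matrix.transpose_transpose, Matrix.mul_assoc]
  rw [Matrix.mul_assoc, hAd, hdt]
  have hPt : (M * Z * (Zᵀ * M * Z)⁻¹ * (Zᵀ * M))ᵀ = M * Z * (Zᵀ * M * Z)⁻¹ * (Zᵀ * M) := by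
    rw [Matrix.transpose_mul, Matrix.transpose_mul _ (Zᵀ * M * Z)⁻¹,
      Matrix.transpose_nonsing_inv, hAt]
    simp only [Matrix.transpose_mul, hMt, Matrix.transpose_transpose, Matrix.mul_assoc]
  rw [Matrix.mul_assoc (u + e)ᵀ, ← Matrix.mul_assoc _ (Zᵀ * M) (u + e)]
  generalize M * Z * (Zᵀ * M * Z)⁻¹ * (Zᵀ * M) = P at hPt ⊢
  have hc : eᵀ * P * u = uᵀ * P * e := by
    rw [← one_by_one_transpose (eᵀ * P * u)]
    simp only [Matrix.transpose_mul, hPt, Matrix.transpose_transpose, Matrix.mul_assoc]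
  rw [Matrix.transpose_add, Matrix.add_mul, Matrix.mul_add P, Matrix.mul_add, Matrix.mul_add,
    ← Matrix.mul_assoc, ← Matrix.mul_assoc, ← Matrix.mul_assoc, ← Matrix.mul_assoc, hc, two_smul]
  abel

/-- Decomposition of the least-squares criterion difference into a deterministic
component `gd` and a stochastic component `ge` (eqs. (A.2.0)–(A.2.4)). -/
theorem criterion_difference_decomposition
    (T p q : ℕ) (hT : 0 < T) (hp : 0 < p) (hq : 0 < q)
    (X : Matrix (Fin T) (Fin p) ℝ) (hX : IsUnit (Xᵀ * X))
    (M : Matrix (Fin T) (Fin T) ℝ) (hM : M = 1 - X * (Xᵀ * X)⁻¹ * Xᵀ)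
    (Z0 Z2 : Matrix (Fin T) (Fin q) ℝ)
    (hZ0 : IsUnit (Z0ᵀ * M * Z0)) (hZ2 : IsUnit (Z2ᵀ * M * Z2))
    (δ : Matrix (Fin q) (Fin 1) ℝ) (β : Matrix (Fin p) (Fin 1) ℝ)
    (e : Matrix (Fin T) (Fin 1) ℝ)
    (Y : Matrix (Fin T) (Fin 1) ℝ) (hY : Y = X * β + Z0 * δ + e)
    (d2 : Matrix (Fin q) (Fin 1) ℝ) (hd2 : d2 = (Z2ᵀ * M * Z2)⁻¹ * (Z2ᵀ * M * Y))
    (d0 : Matrix (Fin q) (Fin 1) ℝ) (hd0 : d0 = (Z0ᵀ * M * Z0)⁻¹ * (Z0ᵀ * M * Y))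
    (gd ge : Matrix (Fin 1) (Fin 1) ℝ)
    (hgd : gd = δᵀ * ((Z0ᵀ * M * Z2) * (Z2ᵀ * M * Z2)⁻¹ * (Z2ᵀ * M * Z0)) * δ
              - δᵀ * (Z0ᵀ * M * Z0) * δ)
    (hge : ge = (2 : ℝ) • (δᵀ * (Z0ᵀ * M * Z2) * (Z2ᵀ * M * Z2)⁻¹ * (Z2ᵀ * M * e))
              - (2 : ℝ) • (δᵀ * (Z0ᵀ * (M * e)))
              + eᵀ * M * Z2 * (Z2ᵀ * M * Z2)⁻¹ * (Z2ᵀ * M * e)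
              - eᵀ * M * Z0 * (Z0ᵀ * M * Z0)⁻¹ * (Z0ᵀ * M * e)) :
    d2ᵀ * (Z2ᵀ * M * Z2) * d2 - d0ᵀ * (Z0ᵀ * M * Z0) * d0 = gd + ge := by
  have hMt : Mᵀ = M := by
    rw [hM, Matrix.transpose_sub, Matrix.transpose_mul, Matrix.transpose_mul,
      Matrix.transpose_nonsing_inv]
    simp [Matrix.transpose_mul, Matrix.mul_assoc]
  have hMX : M * X = 0 := by
    rw [hM, Matrix.sub_mul, Matrix.mul_assoc, Matrix.mul_assoc,
      Matrix.nonsing_inv_mul _ ((Matrix.isUnit_iff_isUnit_det _).1 hX)]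
    simp
  have hMY : M * Y = M * (Z0 * δ + e) := by
    rw [hY, add_assoc, Matrix.mul_add, ← Matrix.mul_assoc, hMX]
    simp
  have h0 : Z0ᵀ * (M * Z0 * (Z0ᵀ * M * Z0)⁻¹ * (Z0ᵀ * M)) = Z0ᵀ * M := by
    rw [← Matrix.mul_assoc, ← Matrix.mul_assoc Z0ᵀ (M * Z0), ← Matrix.mul_assoc Z0ᵀ M Z0,
      Matrix.mul_nonsing_inv _ ((Matrix.isUnit_iff_isUnit_det _).1 hZ0), Matrix.one_mul]
  rw [criterion_expand M hMt Z2 hZ2 _ e Y hMY d2 hd2,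
    criterion_expand M hMt Z0 hZ0 _ e Y hMY d0 hd0, Matrix.transpose_mul,
    Matrix.mul_assoc δᵀ Z0ᵀ (M * Z0 * (Z0ᵀ * M * Z0)⁻¹ * (Z0ᵀ * M)), h0, hgd, hge]
  generalize (Z0ᵀ * M * Z0)⁻¹ = B0
  generalize (Z2ᵀ * M * Z2)⁻¹ = B2
  simp only [Matrix.mul_assoc]
  abel
end

section
/- Let l : ℝ → ℝ belong to the class 𝐋 with growth exponent m > 0, and let θ be a real number with 0 < θ < 1/m (and θ < 1). Then there exists B₀ ≥ 1 such that for every real B ≥ B₀, sup{ l(u) : |u| ≤ B^θ } ≤ inf{ l(u) : |u| > B }; equivalently, l(u) − inf{ l(v) : |v| > B } ≤ 0 whenever |u| ≤ B^θ. -/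
/-- Relationship (10.8): for a loss function `l` in the class 𝐋 with growth exponent `m`
and `0 < θ < 1/m` (with `θ < 1`), there exists `B₀ ≥ 1` such that for all `B ≥ B₀`,
`sup { l u : |u| ≤ B^θ } ≤ inf { l u : |u| > B }`; equivalently,
`l u − inf { l v : |v| > B } ≤ 0` whenever `|u| ≤ B^θ`. -/
theorem lossClass_sup_le_inf_far (l : ℝ → ℝ) (m : ℝ) (hm : 0 < m)
    (hpos : ∀ r : ℝ, 0 ≤ l r) (hzero : ∀ r : ℝ, l r = 0 ↔ r = 0)
    (hcont : ContinuousAt l 0) (hconv : ConvexOn ℝ Set.univ l)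
    (hgrowth : ∀ r : ℝ, l r ≤ 1 + |r| ^ m)
    (θ : ℝ) (hθ0 : 0 < θ) (hθm : θ < 1 / m) (hθ1 : θ < 1) :
    ∃ B0 : ℝ, 1 ≤ B0 ∧ ∀ B : ℝ, B0 ≤ B →
      sSup (l '' {u : ℝ | |u| ≤ B ^ θ}) ≤ sInf (l '' {u : ℝ | B < |u|}) ∧
        ∀ u : ℝ, |u| ≤ B ^ θ → l u - sInf (l '' {v : ℝ | B < |v|}) ≤ 0 := by
  have hl0 : l 0 = 0 := (hzero 0).2 rfl
  obtain ⟨c, hc, hc1, hc2⟩ : ∃ c : ℝ, 0 < c ∧ c ≤ l 1 ∧ c ≤ l (-1) := by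
    refine ⟨min (l 1) (l (-1)), lt_min ?_ ?_, min_le_left _ _, min_le_right _ _⟩
    · exact lt_of_le_of_ne (hpos 1) (fun h => one_ne_zero ((hzero 1).1 h.symm))
    · refine lt_of_le_of_ne (hpos (-1)) (fun h => ?_)
      have := (hzero (-1)).1 h.symm
      norm_num at this
  have hlow : ∀ v : ℝ, 1 < |v| → c * |v| ≤ l v := by
    intro v hv
    have hv0 : 0 < |v| := by linarith
    have ht : 0 ≤ 1 - 1 / |v| := by
      rw [sub_nonneg, div_le_one hv0]; exact hv.le
    have h := hconv.2 (Set.mem_univ v) (Set.mem_univ (0 : ℝ))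
      (by positivity : 0 ≤ 1 / |v|) ht (by ring)
    simp only [smul_eq_mul, mul_zero, add_zero, hl0] at h
    have hc3 : c ≤ l (1 / |v| * v) := by
      rcases le_total 0 v with h0 | h0
      · rw [abs_of_nonneg h0] at hv0 ⊢
        rwa [one_div_mul_cancel hv0.ne']
      · rw [abs_of_nonpos h0] at hv0 ⊢
        have : 1 / (-v) * v = -1 := by
          have hv1 : v ≠ 0 := by intro h; simp [h] at hv0
          field_simp
        rwa [this]
    have h2 : c ≤ 1 / |v| * l v := hc3.trans h
    rw [one_div_mul_eq_div, le_div_iff₀ hv0] at h2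
    exact h2
  have ha : 0 < 1 - θ * m := by
    rw [lt_div_iff₀ hm] at hθm
    linarith
  obtain ⟨B1, hB1⟩ := Filter.eventually_atTop.1
    ((tendsto_rpow_atTop ha).eventually_ge_atTop (2 / c))
  refine ⟨max 1 B1, le_max_left _ _, fun B hB => ?_⟩
  have hB1' : 1 ≤ B := (le_max_left _ _).trans hB
  have hB0 : 0 < B := by linarith
  have hk := hB1 B ((le_max_right _ _).trans hB)
  have hkey : 1 + B ^ (θ * m) ≤ c * B := by
    have h1 : 1 ≤ B ^ (θ * m) := Real.one_le_rpow hB1' (by positivity)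
    have h2 : B ^ (1 - θ * m) * B ^ (θ * m) = B := by
      rw [← Real.rpow_add hB0]; simp
    rw [div_le_iff₀ hc] at hk
    calc 1 + B ^ (θ * m) ≤ 2 * B ^ (θ * m) := by linarith
      _ ≤ (B ^ (1 - θ * m) * c) * B ^ (θ * m) := by gcongr
      _ = c * (B ^ (1 - θ * m) * B ^ (θ * m)) := by ring
      _ = c * B := by rw [h2]
  have hup : ∀ u : ℝ, |u| ≤ B ^ θ → l u ≤ c * B := by
    intro u hu
    refine ((hgrowth u).trans ?_).trans hkey
    rw [Real.rpow_mul hB0.le]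
    gcongr
  have hinf : c * B ≤ sInf (l '' {v : ℝ | B < |v|}) := by
    refine le_csInf ⟨l (B + 1), B + 1, ?_, rfl⟩ ?_
    · exact lt_of_lt_of_le (by linarith) (le_abs_self (B + 1))
    · rintro _ ⟨v, hv, rfl⟩
      have hv' : B < |v| := hv
      exact (mul_le_mul_of_nonneg_left hv'.le hc.le).trans (hlow v (by linarith))
  refine ⟨?_, fun u hu => by linarith [hup u hu]⟩
  refine le_trans ?_ hinf
  refine csSup_le ⟨l 0, 0, ?_, rfl⟩ ?_
  · show |(0 : ℝ)| ≤ B ^ θ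
    rw [abs_zero]; positivity
  · rintro _ ⟨u, hu, rfl⟩
    exact hup u hu
end

section
/- Let ū > 0 and K = [−ū, ū] ⊂ ℝ. Let f : K → ℝ be continuous with a unique maximizer u* ∈ K, i.e. f(u) < f(u*) for all u ∈ K with u ≠ u*. Let π : K → ℝ be continuous with π(u) ≥ c for some c > 0 and all u ∈ K. Let (f_T) be a sequence of measurable functions from K to ℝ with sup_{u ∈ K} |f_T(u) − f(u)| → 0 as T → ∞, and let (γ_T) be a sequence of positive reals with γ_T → ∞. Then the Gibbs posterior mean (∫_K u · exp(γ_T f_T(u)) π(u) du) / (∫_K exp(γ_T f_T(u)) π(u) du) converges to u* as T → ∞. -/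
open MeasureTheory Filter

/-- Deterministic Laplace-type concentration (core of Lemma C.1 / Proposition 3.2):
if `f_T → f` uniformly on `K = [−ū, ū]`, `f` is continuous with a unique maximizer `u*`,
`π` is continuous and bounded below by `c > 0` on `K`, and `γ_T → ∞`, then the Gibbs
posterior mean `(∫_K u e^{γ_T f_T(u)} π(u) du) / (∫_K e^{γ_T f_T(u)} π(u) du) → u*`. -/
theorem gibbs_posterior_mean_tendsto_argmax
    (ub : ℝ) (hub : 0 < ub)
    (f : ℝ → ℝ) (hf : ContinuousOn f (Set.Icc (-ub) ub))
    (ustar : ℝ) (hustar : ustar ∈ Set.Icc (-ub) ub)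
    (hmax : ∀ u ∈ Set.Icc (-ub) ub, u ≠ ustar → f u < f ustar)
    (w : ℝ → ℝ) (hwcont : ContinuousOn w (Set.Icc (-ub) ub))
    (c : ℝ) (hc : 0 < c) (hw : ∀ u ∈ Set.Icc (-ub) ub, c ≤ w u)
    (fT : ℕ → ℝ → ℝ) (hmeas : ∀ T : ℕ, Measurable (fT T))
    (hunif : ∀ ε : ℝ, 0 < ε → ∃ N : ℕ, ∀ T ≥ N, ∀ u ∈ Set.Icc (-ub) ub, |fT T u - f u| ≤ ε)
    (γ : ℕ → ℝ) (hγpos : ∀ T : ℕ, 0 < γ T) (hγ : Tendsto γ atTop atTop) :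
    Tendsto
      (fun T : ℕ =>
        (∫ u in Set.Icc (-ub) ub, u * Real.exp (γ T * fT T u) * w u) /
        (∫ u in Set.Icc (-ub) ub, Real.exp (γ T * fT T u) * w u))
      atTop (nhds ustar) := by
  obtain ⟨M, hM⟩ := isCompact_Icc.exists_bound_of_continuousOn hwcont
  have hM' : ∀ u ∈ Set.Icc (-ub) ub, w u ≤ M := fun u hu => (le_abs_self _).trans (hM u hu)
  have hM0 : 0 < M := hc.trans_le ((hw _ hustar).trans (hM' _ hustar))
  have hfle : ∀ u ∈ Set.Icc (-ub) ub, f u ≤ f ustar := by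
    intro u hu
    by_cases h : u = ustar
    · rw [h]
    · exact (hmax u hu h).le
  rw [Metric.tendsto_atTop]
  intro ε hε
  obtain ⟨δ, hδ, hδε⟩ : ∃ δ : ℝ, 0 < δ ∧ ε = 2 * δ := ⟨ε / 2, by positivity, by ring⟩
  -- separation
  obtain ⟨η, hη, hfar⟩ : ∃ η : ℝ, 0 < η ∧
      ∀ u ∈ Set.Icc (-ub) ub, δ ≤ |u - ustar| → f u ≤ f ustar - 4 * η := by
    have hcomp : IsCompact (Set.Icc (-ub) ub ∩ {u | δ ≤ |u - ustar|}) :=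
      isCompact_Icc.inter_right (isClosed_le (by fun_prop) (by fun_prop))
    rcases (Set.Icc (-ub) ub ∩ {u | δ ≤ |u - ustar|}).eq_empty_or_nonempty with he | hne
    · refine ⟨1, one_pos, fun u hu h => ?_⟩
      have : u ∈ Set.Icc (-ub) ub ∩ {u | δ ≤ |u - ustar|} := ⟨hu, h⟩
      rw [he] at this
      exact this.elim
    · obtain ⟨v, hv, hvm⟩ := hcomp.exists_isMaxOn hne (hf.mono Set.inter_subset_left)
      have hvlt : f v < f ustar := by
        refine hmax v hv.1 ?_
        rintro rfl
        have := hv.2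
        simp at this
        linarith
      refine ⟨(f ustar - f v) / 4, by linarith, fun u hu h => ?_⟩
      have : f u ≤ f v := hvm (show u ∈ Set.Icc (-ub) ub ∩ {u | δ ≤ |u - ustar|} from ⟨hu, h⟩)
      linarith
  -- near interval
  obtain ⟨a, b, hab, hsub, hnear⟩ : ∃ a b : ℝ, a < b ∧ Set.Icc a b ⊆ Set.Icc (-ub) ub ∧
      ∀ u ∈ Set.Icc a b, f ustar - η ≤ f u := by
    obtain ⟨r, hr, hrf⟩ := Metric.continuousOn_iff.1 hf ustar hustar η hη
    have hsub : Set.Icc (max (-ub) (ustar - r / 2)) (min ub (ustar + r / 2)) ⊆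
        Set.Icc (-ub) ub := Set.Icc_subset_Icc (le_max_left _ _) (min_le_left _ _)
    refine ⟨_, _, ?_, hsub, fun u hu => ?_⟩
    · have h1 := hustar.1
      have h2 := hustar.2
      rw [max_lt_iff, lt_min_iff, lt_min_iff]
      refine ⟨⟨?_, ?_⟩, ?_, ?_⟩ <;> linarith
    · have h1 := (le_max_right _ _).trans hu.1
      have h2 := hu.2.trans (min_le_right _ _)
      have := hrf u (hsub hu) (by rw [Real.dist_eq, abs_lt]; constructor <;> linarith)
      rw [Real.dist_eq, abs_lt] at this
      linarith [this.1]
  obtain ⟨N₁, hN₁⟩ := hunif η hη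
  have hlim : Tendsto (fun T => (2 * ub) * (2 * ub * M) / (c * (b - a)) * Real.exp (-(γ T * η)))
      atTop (nhds 0) := by
    have := (Real.tendsto_exp_neg_atTop_nhds_zero.comp (hγ.atTop_mul_const hη)).const_mul
      ((2 * ub) * (2 * ub * M) / (c * (b - a)))
    simpa [Function.comp_def] using this
  obtain ⟨N₂, hN₂⟩ := eventually_atTop.1 (hlim.eventually (gt_mem_nhds hδ))
  refine ⟨max N₁ N₂, fun T hT => ?_⟩
  have hu := hN₁ T ((le_max_left _ _).trans hT)
  have hsmall := hN₂ T ((le_max_right _ _).trans hT)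
  have hγT := hγpos T
  set g : ℝ → ℝ := fun u => Real.exp (γ T * fT T u) * w u with hg
  have hg0 : ∀ u ∈ Set.Icc (-ub) ub, 0 ≤ g u := fun u hu' =>
    mul_nonneg (Real.exp_pos _).le (hc.le.trans (hw u hu'))
  have hfin : volume (Set.Icc (-ub) ub) ≠ ⊤ := by simp
  have hgm : AEStronglyMeasurable g (volume.restrict (Set.Icc (-ub) ub)) :=
    (Real.measurable_exp.comp ((hmeas T).const_mul (γ T))).aestronglyMeasurable.mul
      (hwcont.aestronglyMeasurable measurableSet_Icc)
  have hgi : IntegrableOn g (Set.Icc (-ub) ub) := by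
    refine IntegrableOn.of_bound hfin.lt_top hgm (Real.exp (γ T * (f ustar + η)) * M) ?_
    refine (ae_restrict_iff' measurableSet_Icc).2 (Eventually.of_forall fun u hu' => ?_)
    rw [Real.norm_of_nonneg (hg0 u hu')]
    have h1 := (abs_le.1 (hu u hu')).2
    have h2 := hfle u hu'
    refine mul_le_mul (Real.exp_le_exp.2 (mul_le_mul_of_nonneg_left (by linarith) hγT.le))
      (hM' u hu') (hc.le.trans (hw u hu')) (Real.exp_pos _).le
  have hugi : IntegrableOn (fun u => u * g u) (Set.Icc (-ub) ub) :=
    hgi.continuousOn_mul continuousOn_id isCompact_Icc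
  have hdgi : IntegrableOn (fun u => (u - ustar) * g u) (Set.Icc (-ub) ub) :=
    hgi.continuousOn_mul (by fun_prop) isCompact_Icc
  set D : ℝ := ∫ u in Set.Icc (-ub) ub, g u with hD
  have hDlow : c * (b - a) * Real.exp (γ T * (f ustar - 2 * η)) ≤ D := by
    have h1 : ∫ u in Set.Icc a b, g u ≤ D := by
      refine setIntegral_mono_set hgi ?_ (LE.le.eventuallyLE hsub)
      exact (ae_restrict_iff' measurableSet_Icc).2 (Eventually.of_forall hg0)
    have h2 : ∫ u in Set.Icc a b, (Real.exp (γ T * (f ustar - 2 * η)) * c) ≤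
        ∫ u in Set.Icc a b, g u := by
      refine setIntegral_mono_on continuous_const.integrableOn_Icc (hgi.mono_set hsub) measurableSet_Icc
        fun u hu' => ?_
      have h3 := (abs_le.1 (hu u (hsub hu'))).1
      have h4 := hnear u hu'
      exact mul_le_mul (Real.exp_le_exp.2 (mul_le_mul_of_nonneg_left (by linarith) hγT.le))
        (hw u (hsub hu')) hc.le (Real.exp_pos _).le
    rw [setIntegral_const, smul_eq_mul, Real.volume_real_Icc_of_le hab.le] at h2
    linarith
  have hba : 0 < b - a := sub_pos.2 hab
  have hDpos : 0 < D := lt_of_lt_of_le (by positivity) hDlow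
  have hnum : (∫ u in Set.Icc (-ub) ub, u * Real.exp (γ T * fT T u) * w u) - ustar * D =
      ∫ u in Set.Icc (-ub) ub, (u - ustar) * g u := by
    rw [hD, ← integral_const_mul, ← integral_sub (by simpa [hg, mul_assoc, IntegrableOn] using hugi)
      (hgi.const_mul _)]
    refine integral_congr_ae (Eventually.of_forall fun u => ?_)
    simp only [hg]
    ring
  set E : ℝ := Real.exp (γ T * (f ustar - 3 * η)) with hE
  have hE0 : 0 < E := Real.exp_pos _
  have habs : |∫ u in Set.Icc (-ub) ub, (u - ustar) * g u| ≤
      δ * D + (2 * ub) * (2 * ub * M) * E := by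
    have h1 : |∫ u in Set.Icc (-ub) ub, (u - ustar) * g u| ≤
        ∫ u in Set.Icc (-ub) ub, |(u - ustar) * g u| := abs_integral_le_integral_abs
    have hci : IntegrableOn (fun _ : ℝ => 2 * ub * (E * M)) (Set.Icc (-ub) ub) :=
      continuous_const.integrableOn_Icc
    have h2 : ∫ u in Set.Icc (-ub) ub, |(u - ustar) * g u| ≤
        ∫ u in Set.Icc (-ub) ub, (δ * g u + 2 * ub * (E * M)) := by
      refine setIntegral_mono_on hdgi.abs ((hgi.const_mul δ).add hci) measurableSet_Icc
        fun u hu' => ?_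
      rw [abs_mul, abs_of_nonneg (hg0 u hu')]
      rcases le_or_gt δ |u - ustar| with h | h
      · have h3 := hfar u hu' h
        have h4 := (abs_le.1 (hu u hu')).2
        have h5 : g u ≤ E * M :=
          mul_le_mul (Real.exp_le_exp.2 (mul_le_mul_of_nonneg_left (by linarith) hγT.le))
            (hM' u hu') (hc.le.trans (hw u hu')) (Real.exp_pos _).le
        have h6 : |u - ustar| ≤ 2 * ub := by
          rw [abs_le]
          constructor <;> linarith [hu'.1, hu'.2, hustar.1, hustar.2]
        have h7 := mul_le_mul h6 h5 (hg0 u hu') (by positivity)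
        have h8 := mul_nonneg hδ.le (hg0 u hu')
        linarith
      · have h7 := mul_le_mul_of_nonneg_right h.le (hg0 u hu')
        have h8 : 0 ≤ 2 * ub * (E * M) := by positivity
        linarith
    rw [integral_add (hgi.const_mul δ) hci, integral_const_mul, setIntegral_const, smul_eq_mul,
      Real.volume_real_Icc_of_le (by linarith)] at h2
    linarith
  have hEexp : E = Real.exp (γ T * (f ustar - 2 * η)) * Real.exp (-(γ T * η)) := by
    rw [hE, ← Real.exp_add]
    ring_nf
  have htail : (2 * ub) * (2 * ub * M) * E < δ * D := by
    have h1 : (2 * ub) * (2 * ub * M) * E =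
        ((2 * ub) * (2 * ub * M) / (c * (b - a)) * Real.exp (-(γ T * η))) *
          (c * (b - a) * Real.exp (γ T * (f ustar - 2 * η))) := by
      rw [hEexp]
      field_simp
    rw [h1]
    exact (mul_lt_mul_of_pos_right hsmall (by positivity)).trans_le
      (mul_le_mul_of_nonneg_left hDlow hδ.le)
  rw [Real.dist_eq]
  have hfinal : (∫ u in Set.Icc (-ub) ub, u * Real.exp (γ T * fT T u) * w u) / D - ustar =
      (∫ u in Set.Icc (-ub) ub, (u - ustar) * g u) / D := by
    rw [← hnum]
    field_simp
  rw [hfinal, abs_div, abs_of_pos hDpos, div_lt_iff₀ hDpos, hδε]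
  linarith
end

section
/- Let K ⊂ ℝ be a compact interval, let f : K → ℝ be continuous, and set M = max_{u ∈ K} f(u). Let (f_T) be a sequence of measurable functions from K to ℝ with ε_T := sup_{u ∈ K} |f_T(u) − f(u)| → 0 as T → ∞. Fix c > 0 such that the set { u ∈ K : |f(u) − M| = c } has Lebesgue measure zero. Define S_T = { u ∈ K : |f_T(u) − M| ≤ c } and S = { u ∈ K : |f(u) − M| ≤ c }. Then the Lebesgue measure of the symmetric difference, Leb(S_T \ S) + Leb(S \ S_T), converges to 0 as T → ∞. -/
open Filter MeasureTheory

/-- Equation (34) in the proof of Lemma C.1: near-maximum level sets of the sample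
criterion converge in Lebesgue measure to those of the limit criterion under uniform
convergence, provided the boundary level set `{ |f − M| = c }` is Lebesgue-null. -/
theorem level_sets_converge_in_measure
    (a b : ℝ) (hab : a ≤ b) (f : ℝ → ℝ) (hf : ContinuousOn f (Set.Icc a b))
    (M : ℝ) (hM : IsGreatest (f '' Set.Icc a b) M)
    (fT : ℕ → ℝ → ℝ) (hmeas : ∀ T : ℕ, Measurable (fT T))
    (hunif : ∀ ε : ℝ, 0 < ε → ∃ N : ℕ, ∀ T ≥ N, ∀ u ∈ Set.Icc a b, |fT T u - f u| ≤ ε)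
    (c : ℝ) (hc : 0 < c)
    (hnull : volume {u ∈ Set.Icc a b | |f u - M| = c} = 0) :
    Tendsto
      (fun T : ℕ =>
        volume ({u ∈ Set.Icc a b | |fT T u - M| ≤ c} \ {u ∈ Set.Icc a b | |f u - M| ≤ c}) +
        volume ({u ∈ Set.Icc a b | |f u - M| ≤ c} \ {u ∈ Set.Icc a b | |fT T u - M| ≤ c}))
      atTop (nhds 0) := by
  set A : ℕ → Set ℝ := fun n => {u ∈ Set.Icc a b | |(|f u - M| - c)| ≤ 1 / ((n : ℝ) + 1)} with hA
  have hAm : ∀ n, MeasurableSet (A n) := by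
    intro n
    have hcont : ContinuousOn (fun u => |(|f u - M| - c)|) (Set.Icc a b) :=
      (((hf.sub continuousOn_const).abs).sub continuousOn_const).abs
    exact (hcont.preimage_isClosed_of_isClosed isClosed_Icc isClosed_Iic).measurableSet
  have hanti : Antitone A := by
    intro m n hmn u hu
    exact ⟨hu.1, hu.2.trans (Nat.one_div_le_one_div hmn)⟩
  have hlim : Tendsto (fun n => volume (A n)) atTop (nhds (volume (⋂ n, A n))) := by
    refine tendsto_measure_iInter_atTop (fun n => (hAm n).nullMeasurableSet) hanti ⟨0, ?_⟩
    exact ((measure_mono (fun u hu => hu.1)).trans_lt (measure_Icc_lt_top (a := a) (b := b))).ne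
  have hzero : volume (⋂ n, A n) = 0 := by
    refine measure_mono_null ?_ hnull
    intro u hu
    have hu' : ∀ n, u ∈ A n := Set.mem_iInter.1 hu
    refine ⟨(hu' 0).1, ?_⟩
    have h0 : |(|f u - M| - c)| ≤ 0 :=
      ge_of_tendsto' tendsto_one_div_add_atTop_nhds_zero_nat (fun n => (hu' n).2)
    have := abs_nonpos_iff.1 h0
    linarith
  rw [hzero] at hlim
  have hlim2 : Tendsto (fun n => volume (A n) + volume (A n)) atTop (nhds 0) := by
    simpa using hlim.add hlim
  rw [ENNReal.tendsto_nhds_zero] at hlim2 ⊢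
  intro δ hδ
  obtain ⟨n, hn⟩ := (hlim2 δ hδ).exists
  obtain ⟨N, hN⟩ := hunif (1 / ((n : ℝ) + 1)) (by positivity)
  filter_upwards [eventually_ge_atTop N] with T hT
  have key : ∀ u ∈ Set.Icc a b, |(|fT T u - M| - |f u - M|)| ≤ 1 / ((n : ℝ) + 1) := by
    intro u hu
    refine (abs_abs_sub_abs_le_abs_sub _ _).trans ?_
    have := hN T hT u hu
    rwa [sub_sub_sub_cancel_right]
  refine le_trans (add_le_add (measure_mono ?_) (measure_mono ?_)) hn
  · rintro u ⟨⟨hu, h1⟩, h2⟩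
    have h3 : c < |f u - M| := by
      by_contra h
      exact h2 ⟨hu, not_lt.1 h⟩
    have := abs_le.1 (key u hu)
    exact ⟨hu, abs_le.2 ⟨by linarith, by linarith⟩⟩
  · rintro u ⟨⟨hu, h1⟩, h2⟩
    have h3 : c < |fT T u - M| := by
      by_contra h
      exact h2 ⟨hu, not_lt.1 h⟩
    have := abs_le.1 (key u hu)
    exact ⟨hu, abs_le.2 ⟨by linarith, by linarith⟩⟩
end

section
/- Let l : ℝ → ℝ belong to the class 𝐋, let p : ℝ → [0, ∞) be measurable, and define the risk S(s) = ∫_ℝ l(s − u) p(u) du ∈ [0, ∞]. Assume S(0) < ∞. Let 0 < ū₁ < ū₂ and set L̄₁ = sup{ l(u) : |u| ≤ ū₁ } and L₂ = inf{ l(u) : |u| > ū₂ }. Let B ≥ 2ū₂ and θ ∈ (0,1) be such that ū₁ ≤ (B/2)^θ ≤ B/2 and sup{ l(u) : |u| ≤ (B/2)^θ } ≤ inf{ l(w) : |w| > B/2 }. Then for every real s with |s| > B: S(0) − S(s) ≤ −(L₂ − L̄₁) · ∫_{|u| ≤ ū₁} p(u) du + ∫_{|u| > (B/2)^θ} l(−u)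 p(u) du. -/
open MeasureTheory

/-- The class 𝐋 of loss functions: nonnegative, vanishing exactly at 0,
continuous at 0, convex, with polynomial growth `l r ≤ 1 + |r|^m` for some `m > 0`. -/
def MemLossClassL (l : ℝ → ℝ) : Prop :=
  (∀ r : ℝ, 0 ≤ l r) ∧ (∀ r : ℝ, l r = 0 ↔ r = 0) ∧ ContinuousAt l 0 ∧
    ConvexOn ℝ Set.univ l ∧ ∃ m : ℝ, 0 < m ∧ ∀ r : ℝ, l r ≤ 1 + |r| ^ m

/-- The expected-risk functional `S(s) = ∫ l(s − u) p(u) du ∈ [0, ∞]`. -/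
noncomputable def risk (l p : ℝ → ℝ) (s : ℝ) : ENNReal :=
  ∫⁻ u : ℝ, ENNReal.ofReal (l (s - u) * p u)

/-- Relation (5.14): for `l ∈ 𝐋` and `|s| > B`,
`S(0) − S(s) ≤ −(L₂ − L̄₁)·∫_{|u|≤ū₁} p + ∫_{|u|>(B/2)^θ} l(−u) p(u) du`,
stated in the rearranged (extended-real) form
`S(0) + (L₂ − L̄₁)·∫_{|u|≤ū₁} p ≤ S(s) + ∫_{|u|>(B/2)^θ} l(−u) p(u) du`,
where `L̄₁ = sup{l u : |u| ≤ ū₁}` and `L₂ = inf{l u : |u| > ū₂}`. -/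
theorem risk_gap_bound (l : ℝ → ℝ) (hl : MemLossClassL l)
    (p : ℝ → ℝ) (hpmeas : Measurable p) (hp0 : ∀ u : ℝ, 0 ≤ p u)
    (hS0 : risk l p 0 < ⊤)
    (u1 u2 B θ : ℝ)
    (hu1 : 0 < u1) (hu12 : u1 < u2) (hB : 2 * u2 ≤ B)
    (hθ0 : 0 < θ) (hθ1 : θ < 1)
    (hlow : u1 ≤ (B / 2) ^ θ) (hhigh : (B / 2) ^ θ ≤ B / 2)
    (hsupinf : sSup (l '' {u : ℝ | |u| ≤ (B / 2) ^ θ}) ≤ sInf (l '' {w : ℝ | B / 2 < |w|})) :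
    ∀ s : ℝ, B < |s| →
      risk l p 0 +
          ENNReal.ofReal
              (sInf (l '' {u : ℝ | u2 < |u|}) - sSup (l '' {u : ℝ | |u| ≤ u1})) *
            (∫⁻ u in {u : ℝ | |u| ≤ u1}, ENNReal.ofReal (p u)) ≤
        risk l p s + ∫⁻ u in {u : ℝ | (B / 2) ^ θ < |u|}, ENNReal.ofReal (l (-u) * p u) := by
  intro s hs
  obtain ⟨h0, -, -, hconv, m, hm, hgrow⟩ := hl
  have hcont : Continuous l := by
    rw [← continuousOn_univ]
    exact hconv.continuousOn isOpen_univ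
  have hle : ∀ R u : ℝ, |u| ≤ R → l u ≤ sSup (l '' {u : ℝ | |u| ≤ R}) := by
    intro R u hu
    refine le_csSup ⟨1 + R ^ m, ?_⟩ ⟨u, hu, rfl⟩
    rintro _ ⟨v, hv, rfl⟩
    have h1 := hgrow v
    have h2 : |v| ^ m ≤ R ^ m := Real.rpow_le_rpow (abs_nonneg v) hv hm.le
    linarith
  have hge : ∀ R u : ℝ, R < |u| → sInf (l '' {u : ℝ | R < |u|}) ≤ l u := by
    intro R u hu
    refine csInf_le ⟨0, ?_⟩ ⟨u, hu, rfl⟩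
    rintro _ ⟨v, hv, rfl⟩
    exact h0 v
  have hM1 : MeasurableSet {u : ℝ | |u| ≤ u1} := measurableSet_le (by fun_prop) (by fun_prop)
  have hM2 : MeasurableSet {u : ℝ | (B / 2) ^ θ < |u|} :=
    measurableSet_lt (by fun_prop) (by fun_prop)
  have hlm := hcont.measurable
  unfold risk
  rw [← lintegral_const_mul _ (by fun_prop), ← lintegral_indicator hM1,
    ← lintegral_indicator hM2, ← lintegral_add_left (by fun_prop),
    ← lintegral_add_left (by fun_prop)]
  refine lintegral_mono fun u => ?_
  simp only [Set.indicator, Set.mem_setOf_eq, zero_sub]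
  by_cases hu : (B / 2) ^ θ < |u|
  · rw [if_neg (by linarith), if_pos hu, add_zero]
    exact le_add_self
  · have hu' := not_lt.mp hu
    have hsu : B / 2 < |s - u| := by
      have := abs_sub_abs_le_abs_sub s u
      linarith
    have hA : l (-u) ≤ l (s - u) :=
      (hle _ (-u) (by rwa [abs_neg])).trans (hsupinf.trans (hge _ _ hsu))
    have hA' : l (-u) * p u ≤ l (s - u) * p u := mul_le_mul_of_nonneg_right hA (hp0 u)
    rw [if_neg hu, add_zero]
    split_ifs with h1
    · have hb1 := hle u1 (-u) (by rwa [abs_neg])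
      have hb2 := hge u2 (s - u) (by linarith)
      rcases le_total 0 (sInf (l '' {u : ℝ | u2 < |u|}) - sSup (l '' {u : ℝ | |u| ≤ u1}))
        with hc | hc
      · rw [← ENNReal.ofReal_mul hc, ← ENNReal.ofReal_add (mul_nonneg (h0 _) (hp0 u))
          (mul_nonneg hc (hp0 u)), ← add_mul]
        exact ENNReal.ofReal_le_ofReal (mul_le_mul_of_nonneg_right (by linarith) (hp0 u))
      · rw [ENNReal.ofReal_of_nonpos hc, zero_mul, add_zero]
        exact ENNReal.ofReal_le_ofReal hA'
    · rw [add_zero]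
      exact ENNReal.ofReal_le_ofReal hA'
end

section
/- Let l : ℝ → ℝ belong to the class 𝐋, let p : ℝ → [0, ∞) be measurable, and define S(s) = ∫_ℝ l(s − u) p(u) du ∈ [0, ∞]. Assume S(0) < ∞. Let 0 < ū₁ < ū₂, L̄₁ = sup{ l(u) : |u| ≤ ū₁ }, L₂ = inf{ l(u) : |u| > ū₂ }, and let B ≥ 2ū₂ and θ ∈ (0,1) satisfy ū₁ ≤ (B/2)^θ ≤ B/2 and sup{ l(u) : |u| ≤ (B/2)^θ } ≤ inf{ l(w) : |w| > B/2 }. If moreover ∫_{|u| > (B/2)^θ} l(−u) p(u) du < (L₂ − L̄₁) · ∫_{|u| ≤ ū₁} p(u) du, then S(s) > S(0) for every s with |s| > B; consequently every minimizer s* of S over ℝ satisfies |s*| ≤ B. -/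
open MeasureTheory

/-- Deterministic mechanism behind Proposition 3.1: if the tail contribution to the
expected risk is strictly dominated by `(L₂ − L̄₁)` times the mass near the origin,
then `S(s) > S(0)` for all `|s| > B`, and hence every minimizer `s*` of `S`
satisfies `|s*| ≤ B`. -/
theorem risk_minimizer_bound (l : ℝ → ℝ) (hl : MemLossClassL l)
    (p : ℝ → ℝ) (hpmeas : Measurable p) (hp0 : ∀ u : ℝ, 0 ≤ p u)
    (hS0 : risk l p 0 < ⊤)
    (u1 u2 B θ : ℝ)
    (hu1 : 0 < u1) (hu12 : u1 < u2) (hB : 2 * u2 ≤ B)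
    (hθ0 : 0 < θ) (hθ1 : θ < 1)
    (hlow : u1 ≤ (B / 2) ^ θ) (hhigh : (B / 2) ^ θ ≤ B / 2)
    (hsupinf : sSup (l '' {u : ℝ | |u| ≤ (B / 2) ^ θ}) ≤ sInf (l '' {w : ℝ | B / 2 < |w|}))
    (htail :
      (∫⁻ u in {u : ℝ | (B / 2) ^ θ < |u|}, ENNReal.ofReal (l (-u) * p u)) <
        ENNReal.ofReal
            (sInf (l '' {u : ℝ | u2 < |u|}) - sSup (l '' {u : ℝ | |u| ≤ u1})) *
          (∫⁻ u in {u : ℝ | |u| ≤ u1}, ENNReal.ofReal (p u))) :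
    (∀ s : ℝ, B < |s| → risk l p 0 < risk l p s) ∧
      ∀ sstar : ℝ, (∀ s : ℝ, risk l p sstar ≤ risk l p s) → |sstar| ≤ B := by
  obtain ⟨hl0, -, -, -, m, hm, hgrow⟩ := hl
  have hbdd : ∀ K : ℝ, BddAbove (l '' {u : ℝ | |u| ≤ K}) := by
    intro K
    refine ⟨1 + K ^ m, ?_⟩
    rintro _ ⟨u, hu, rfl⟩
    have h := Real.rpow_le_rpow (abs_nonneg u) hu hm.le
    linarith [hgrow u]
  have hbelow : ∀ t : Set ℝ, BddBelow (l '' t) := by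
    intro t
    refine ⟨0, ?_⟩
    rintro _ ⟨u, -, rfl⟩
    exact hl0 u
  set R := (B / 2) ^ θ with hR
  set c := sInf (l '' {u : ℝ | u2 < |u|}) - sSup (l '' {u : ℝ | |u| ≤ u1}) with hc
  have main : ∀ s : ℝ, B < |s| → risk l p 0 < risk l p s := by
    intro s hs
    have hA : MeasurableSet {u : ℝ | |u| ≤ R} := measurableSet_le (by fun_prop) (by fun_prop)
    have hU : MeasurableSet {u : ℝ | |u| ≤ u1} := measurableSet_le (by fun_prop) (by fun_prop)
    have hAc : {u : ℝ | |u| ≤ R}ᶜ = {u : ℝ | R < |u|} := by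
      ext u; simp
    have hfar : ∀ u : ℝ, |u| ≤ R → B / 2 < |s - u| := by
      intro u hu
      have := abs_sub_abs_le_abs_sub s u
      linarith
    have hmono : ∀ u : ℝ, |u| ≤ R → l (-u) ≤ l (s - u) := by
      intro u hu
      have h1 : l (-u) ≤ sSup (l '' {u : ℝ | |u| ≤ R}) :=
        le_csSup (hbdd R) ⟨-u, by simpa using hu, rfl⟩
      have h2 : sInf (l '' {w : ℝ | B / 2 < |w|}) ≤ l (s - u) :=
        csInf_le (hbelow _) ⟨s - u, hfar u hu, rfl⟩
      linarith
    have hgap : ∀ u : ℝ, |u| ≤ u1 → l (-u) + c ≤ l (s - u) := by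
      intro u hu
      have h1 : l (-u) ≤ sSup (l '' {u : ℝ | |u| ≤ u1}) :=
        le_csSup (hbdd u1) ⟨-u, by simpa using hu, rfl⟩
      have h2 : sInf (l '' {w : ℝ | u2 < |w|}) ≤ l (s - u) :=
        csInf_le (hbelow _) ⟨s - u, by
          have := hfar u (hu.trans hlow)
          simp only [Set.mem_ofPred_eq]
          linarith, rfl⟩
      linarith
    have hcpos : 0 ≤ c := by
      by_contra hneg
      rw [ENNReal.ofReal_of_nonpos (not_le.mp hneg).le, zero_mul] at htail
      exact not_lt_bot htail
    have hsplit : risk l p 0 = (∫⁻ u in {u : ℝ | |u| ≤ R}, ENNReal.ofReal (l (-u) * p u)) +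
        ∫⁻ u in {u : ℝ | R < |u|}, ENNReal.ofReal (l (-u) * p u) := by
      rw [← hAc, lintegral_add_compl _ hA]
      simp [risk]
    have hfin : (∫⁻ u in {u : ℝ | |u| ≤ R}, ENNReal.ofReal (l (-u) * p u)) ≠ ⊤ := by
      refine ne_top_of_le_ne_top hS0.ne ?_
      rw [hsplit]
      exact le_self_add
    have hpm : Measurable fun u => ENNReal.ofReal (p u) := hpmeas.ennreal_ofReal
    have hsub : {u : ℝ | |u| ≤ u1} ⊆ {u : ℝ | |u| ≤ R} :=
      fun u (hu : |u| ≤ u1) => hu.trans hlow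
    have hmass : ENNReal.ofReal c * (∫⁻ u in {u : ℝ | |u| ≤ u1}, ENNReal.ofReal (p u)) =
        ∫⁻ u in {u : ℝ | |u| ≤ R},
          ({u : ℝ | |u| ≤ u1}.indicator (fun u => ENNReal.ofReal c * ENNReal.ofReal (p u))) u := by
      rw [← lintegral_const_mul _ hpm, setLIntegral_indicator hU,
        Set.inter_eq_left.mpr hsub]
    calc risk l p 0 < (∫⁻ u in {u : ℝ | |u| ≤ R}, ENNReal.ofReal (l (-u) * p u)) +
          ENNReal.ofReal c * (∫⁻ u in {u : ℝ | |u| ≤ u1}, ENNReal.ofReal (p u)) := by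
          rw [hsplit]
          exact ENNReal.add_lt_add_left hfin htail
      _ = ∫⁻ u in {u : ℝ | |u| ≤ R}, (ENNReal.ofReal (l (-u) * p u) +
          ({u : ℝ | |u| ≤ u1}.indicator
            (fun u => ENNReal.ofReal c * ENNReal.ofReal (p u))) u) := by
          rw [hmass, lintegral_add_right _ ((hpm.const_mul _).indicator hU)]
      _ ≤ ∫⁻ u in {u : ℝ | |u| ≤ R}, ENNReal.ofReal (l (s - u) * p u) := by
          refine setLIntegral_mono' hA ?_
          intro u hu
          by_cases h : |u| ≤ u1
          · rw [Set.indicator_of_mem (show u ∈ {u : ℝ | |u| ≤ u1} from h),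
              ← ENNReal.ofReal_mul hcpos,
              ← ENNReal.ofReal_add (mul_nonneg (hl0 _) (hp0 _)) (mul_nonneg hcpos (hp0 _)),
              ← add_mul]
            exact ENNReal.ofReal_le_ofReal (mul_le_mul_of_nonneg_right (hgap u h) (hp0 u))
          · rw [Set.indicator_of_notMem (show u ∉ {u : ℝ | |u| ≤ u1} from h), add_zero]
            exact ENNReal.ofReal_le_ofReal (mul_le_mul_of_nonneg_right (hmono u hu) (hp0 u))
      _ ≤ risk l p s := setLIntegral_le_lintegral _ _
  refine ⟨main, fun sstar h => ?_⟩
  by_contra hlt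
  exact absurd (h 0) (not_le.mpr (main sstar (not_le.mp hlt)))
end

section
/- Let r be a positive natural number and let l : ℝ → ℝ be convex and nonnegative with l(u) ≤ 2^r (1 + u²)^r for all u ∈ ℝ. For K > 0 and ϖ > 0 define Υ_K(ϖ) = ∫_ℝ sup{ |l(s + y − u) − l(s − u)| : |s| ≤ K, |y| ≤ ϖ } · (1 + u²)^{−r−1} du. Then for every fixed K > 0, Υ_K(ϖ) → 0 as ϖ → 0⁺. -/
open Filter MeasureTheory

/-- Local Lipschitz bound from convexity and nonnegativity. -/
lemma convex_diff_bound (l : ℝ → ℝ) (hconv : ConvexOn ℝ Set.univ l) (hnn : ∀ u : ℝ, 0 ≤ l u)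
    (M x y : ℝ) (hp : l (x + 1) ≤ M) (hm : l (x - 1) ≤ M) (hy : |y| ≤ 1) :
    |l (x + y) - l x| ≤ |y| * M := by
  have key : ∀ (e t : ℝ), 0 ≤ t → t ≤ 1 → l (x + e) ≤ M → l (x - e) ≤ M →
      |l (x + t * e) - l x| ≤ t * M := by
    intro e t ht0 ht1 h1 h2
    have hx := hnn x
    have a1 := hconv.2 (Set.mem_univ x) (Set.mem_univ (x + e))
      (sub_nonneg.2 ht1) ht0 (by ring)
    have a2 := hconv.2 (Set.mem_univ (x + t * e)) (Set.mem_univ (x - e))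
      (show 0 ≤ 1 / (1 + t) by positivity) (show 0 ≤ t / (1 + t) by positivity)
      (by field_simp)
    simp only [smul_eq_mul] at a1 a2
    have e1 : (1 - t) * x + t * (x + e) = x + t * e := by ring
    have e2 : 1 / (1 + t) * (x + t * e) + t / (1 + t) * (x - e) = x := by
      field_simp
      ring
    have e3 : 1 / (1 + t) * l (x + t * e) + t / (1 + t) * l (x - e)
        = (l (x + t * e) + t * l (x - e)) / (1 + t) := by
      field_simp
    rw [e1] at a1
    rw [e2, e3, le_div_iff₀ (by positivity)] at a2
    have b1 := mul_le_mul_of_nonneg_left h1 ht0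
    have b2 := mul_le_mul_of_nonneg_left h2 ht0
    have b3 := mul_nonneg ht0 hx
    rw [abs_le]
    constructor <;> nlinarith
  rcases le_total 0 y with h | h
  · rw [abs_of_nonneg h] at hy ⊢
    simpa using key 1 y h hy hp hm
  · rw [abs_of_nonpos h] at hy ⊢
    have := key (-1) (-y) (by linarith) hy (by simpa [sub_eq_add_neg] using hm) (by simpa using hp)
    simpa using this

/-- Convergence of the weighted modulus of continuity used for tightness in
Theorem 3.2: for convex nonnegative `l` with `l u ≤ 2^r (1 + u²)^r`, and any fixed
`K > 0`, `Υ_K(ϖ) = ∫ sup_{|s|≤K, |y|≤ϖ} |l(s+y−u) − l(s−u)| (1+u²)^{−r−1} du → 0`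
as `ϖ → 0⁺`. -/
theorem weighted_modulus_tendsto_zero (r : ℕ) (hr : 0 < r) (l : ℝ → ℝ)
    (hconv : ConvexOn ℝ Set.univ l) (hnn : ∀ u : ℝ, 0 ≤ l u)
    (hgrowth : ∀ u : ℝ, l u ≤ 2 ^ r * (1 + u ^ 2) ^ r)
    (K : ℝ) (hK : 0 < K) :
    Tendsto
      (fun ϖ : ℝ => ∫ u : ℝ,
        (⨆ s ∈ {s : ℝ | |s| ≤ K}, ⨆ y ∈ {y : ℝ | |y| ≤ ϖ}, |l (s + y - u) - l (s - u)|) /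
          (1 + u ^ 2) ^ (r + 1))
      (nhdsWithin 0 (Set.Ioi 0)) (nhds 0) := by
  set C : ℝ := 2 ^ r * (2 * (1 + (K + 1) ^ 2)) ^ r with hC
  have hC0 : 0 ≤ C := by positivity
  have hl : ∀ u v : ℝ, |v| ≤ K + 1 → l (v - u) ≤ C * (1 + u ^ 2) ^ r := by
    intro u v hv
    refine (hgrowth _).trans ?_
    rw [hC, mul_assoc, ← mul_pow (2 * (1 + (K + 1) ^ 2))]
    have h2 : v ^ 2 ≤ (K + 1) ^ 2 := sq_le_sq' (abs_le.1 hv).1 (abs_le.1 hv).2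
    gcongr
    nlinarith [sq_nonneg (v + u), mul_nonneg (sq_nonneg (K + 1)) (sq_nonneg u)]
  have hbound : ∀ ϖ : ℝ, 0 < ϖ → ϖ ≤ 1 → ∀ u : ℝ,
      ‖(⨆ s ∈ {s : ℝ | |s| ≤ K}, ⨆ y ∈ {y : ℝ | |y| ≤ ϖ}, |l (s + y - u) - l (s - u)|) /
          (1 + u ^ 2) ^ (r + 1)‖ ≤ ϖ * C * (1 + u ^ 2)⁻¹ := by
    intro ϖ h0 h1 u
    have hB : 0 ≤ ϖ * (C * (1 + u ^ 2) ^ r) := by positivity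
    have hn : 0 ≤ (⨆ s ∈ {s : ℝ | |s| ≤ K}, ⨆ y ∈ {y : ℝ | |y| ≤ ϖ},
        |l (s + y - u) - l (s - u)|) :=
      Real.iSup_nonneg fun s => Real.iSup_nonneg fun _ => Real.iSup_nonneg fun y =>
        Real.iSup_nonneg fun _ => abs_nonneg _
    rw [Real.norm_of_nonneg (by positivity), div_le_iff₀ (by positivity)]
    have e : ϖ * C * (1 + u ^ 2)⁻¹ * (1 + u ^ 2) ^ (r + 1) = ϖ * (C * (1 + u ^ 2) ^ r) := by
      have : (1 + u ^ 2) ≠ 0 := by positivity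
      field_simp
      ring
    rw [e]
    refine Real.iSup_le (fun s => Real.iSup_le (fun hs => Real.iSup_le (fun y =>
      Real.iSup_le (fun hy => ?_) hB) hB) hB) hB
    change |s| ≤ K at hs
    change |y| ≤ ϖ at hy
    have hs' := abs_le.1 hs
    have q1 := hl u (s + 1) (abs_le.2 ⟨by linarith, by linarith⟩)
    have q2 := hl u (s - 1) (abs_le.2 ⟨by linarith, by linarith⟩)
    have q := convex_diff_bound l hconv hnn (C * (1 + u ^ 2) ^ r) (s - u) y
      (by convert q1 using 2; ring) (by convert q2 using 2; ring) (hy.trans h1)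
    have e4 : s + y - u = s - u + y := by ring
    rw [e4]
    exact q.trans (by gcongr)
  have hlim : Tendsto (fun ϖ : ℝ => ϖ * (C * ∫ u : ℝ, (1 + u ^ 2)⁻¹))
      (nhdsWithin 0 (Set.Ioi 0)) (nhds 0) := by
    have h : Tendsto (fun ϖ : ℝ => ϖ * (C * ∫ u : ℝ, (1 + u ^ 2)⁻¹)) (nhds 0) (nhds 0) := by
      have hc : Continuous (fun ϖ : ℝ => ϖ * (C * ∫ u : ℝ, (1 + u ^ 2)⁻¹)) := by fun_prop
      simpa using hc.tendsto 0
    exact h.mono_left nhdsWithin_le_nhds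
  refine squeeze_zero_norm' ?_ hlim
  filter_upwards [Ioc_mem_nhdsGT (show (0 : ℝ) < 1 by norm_num)] with ϖ hϖ
  have := norm_integral_le_of_norm_le (integrable_inv_one_add_sq.const_mul (ϖ * C))
    (Eventually.of_forall (hbound ϖ hϖ.1 hϖ.2))
  rw [integral_const_mul, mul_assoc] at this
  exact this
end

section
/- Let Λ be a measurable space equipped with a probability measure Π, and let 𝒴 be a measurable space equipped with a σ-finite measure ζ. Let p : Λ × 𝒴 → [0, ∞) be jointly measurable with ∫_𝒴 p(λ, y) dζ(y) = 1 for every λ ∈ Λ. Let α ∈ (0, 1) and let φ : Λ × 𝒴 → [0, 1] be jointly measurable such that for ζ-almost every y ∈ 𝒴: ∫_Λ φ(λ, y) p(λ, y) dΠ(λ) ≤ α · ∫_Λ p(λ, y) dΠ(λ). Then for every measurable betting strategy b̃ : 𝒴 → [0, 1] there exists λ ∈ Λ such that the inspector's expected loss L_α(φ, b̃, λ) = (1 − α)⁻¹ ∫_𝒴 (α − φ(λ, y)) b̃(y) p(λ, y) dζ(y) is nonnegative; that is, φ is bet-proof at level 1 − α. -/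
open MeasureTheory

/-- Exact core of Proposition 6.1(i): if the posterior (under prior `prior`)
probability of exclusion is at most `α` for ζ-almost every sample `y`, then the
confidence set `φ` is bet-proof at level `1 − α`: for every measurable betting
strategy `b : 𝒴 → [0,1]` there is a parameter `lam` at which the inspector's
expected loss `L_α(φ, b, lam) = (1−α)⁻¹ ∫ (α − φ(lam, y)) b(y) p(lam, y) dζ(y)`
is nonnegative. -/
theorem credible_set_is_bet_proof
    {Λ : Type*} [MeasurableSpace Λ] (prior : Measure Λ) [IsProbabilityMeasure prior]
    {Y : Type*} [MeasurableSpace Y] (ζ : Measure Y) [SigmaFinite ζ]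
    (p : Λ → Y → ℝ) (hpmeas : Measurable (Function.uncurry p))
    (hp0 : ∀ lam : Λ, ∀ y : Y, 0 ≤ p lam y)
    (hpdens : ∀ lam : Λ, ∫ y, p lam y ∂ζ = 1)
    (α : ℝ) (hα : α ∈ Set.Ioo (0 : ℝ) 1)
    (φ : Λ → Y → ℝ) (hφmeas : Measurable (Function.uncurry φ))
    (hφ01 : ∀ lam : Λ, ∀ y : Y, φ lam y ∈ Set.Icc (0 : ℝ) 1)
    (hpost : ∀ᵐ y ∂ζ,
      (∫ lam, φ lam y * p lam y ∂prior) ≤ α * ∫ lam, p lam y ∂prior) :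
    ∀ b : Y → ℝ, Measurable b → (∀ y : Y, b y ∈ Set.Icc (0 : ℝ) 1) →
      ∃ lam : Λ, 0 ≤ (1 - α)⁻¹ * ∫ y, (α - φ lam y) * b y * p lam y ∂ζ := by
  intro b hb hb01
  have hpi : ∀ lam, Integrable (p lam) ζ := by
    intro lam
    by_contra h
    have h1 := hpdens lam
    rw [integral_undef h] at h1
    exact zero_ne_one h1
  have hP : Integrable (Function.uncurry p) (prior.prod ζ) := by
    rw [integrable_prod_iff hpmeas.aestronglyMeasurable]
    refine ⟨Filter.Eventually.of_forall fun lam => hpi lam, ?_⟩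
    have : (fun lam => ∫ y, ‖Function.uncurry p (lam, y)‖ ∂ζ) = fun _ => (1 : ℝ) := by
      funext lam
      rw [← hpdens lam]
      refine integral_congr_ae (Filter.Eventually.of_forall fun y => ?_)
      simp [Function.uncurry, abs_of_nonneg (hp0 lam y)]
    rw [this]
    exact integrable_const _
  have hbm : Measurable fun z : Λ × Y => b z.2 := hb.comp measurable_snd
  have hF : Integrable (fun z : Λ × Y => (α - φ z.1 z.2) * b z.2 * p z.1 z.2)
      (prior.prod ζ) := by
    refine hP.mono (((measurable_const.sub hφmeas).mul hbm).mul
      hpmeas).aestronglyMeasurable (Filter.Eventually.of_forall fun z => ?_)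
    have h1 : |α - φ z.1 z.2| ≤ 1 := by
      have := hφ01 z.1 z.2
      rw [abs_le]
      constructor <;> linarith [this.1, this.2, hα.1, hα.2]
    have h2 : |b z.2| ≤ 1 := by
      have := hb01 z.2
      rw [abs_le]
      constructor <;> linarith [this.1, this.2]
    have h3 : |α - φ z.1 z.2| * |b z.2| ≤ 1 := mul_le_one₀ h1 (abs_nonneg _) h2
    simp only [Real.norm_eq_abs, abs_mul, Function.uncurry]
    exact mul_le_of_le_one_left (abs_nonneg _) h3
  have hG : Integrable (fun z : Λ × Y => φ z.1 z.2 * p z.1 z.2) (prior.prod ζ) := by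
    refine hP.mono (hφmeas.mul hpmeas).aestronglyMeasurable
      (Filter.Eventually.of_forall fun z => ?_)
    simp only [Real.norm_eq_abs, abs_mul, Function.uncurry]
    refine mul_le_of_le_one_left (abs_nonneg _) ?_
    rw [abs_of_nonneg (hφ01 _ _).1]
    exact (hφ01 _ _).2
  have hnn : 0 ≤ ∫ lam, ∫ y, (α - φ lam y) * b y * p lam y ∂ζ ∂prior := by
    rw [integral_integral_swap hF]
    refine integral_nonneg_of_ae ?_
    filter_upwards [hpost, hP.prod_left_ae, hG.prod_left_ae] with y hy h1 h2
    replace h1 : Integrable (fun lam => p lam y) prior := h1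
    have e : ∫ lam, (α - φ lam y) * b y * p lam y ∂prior =
        b y * (α * (∫ lam, p lam y ∂prior) - ∫ lam, φ lam y * p lam y ∂prior) := by
      rw [← integral_const_mul, ← integral_sub (h1.const_mul α) h2, ← integral_const_mul]
      refine integral_congr_ae (Filter.Eventually.of_forall fun lam => ?_)
      ring
    simp only [Pi.zero_apply]
    rw [e]
    exact mul_nonneg (hb01 y).1 (sub_nonneg.2 hy)
  obtain ⟨lam, hlam⟩ := exists_integral_le hF.integral_prod_left
  exact ⟨lam, mul_nonneg (inv_nonneg.2 (by linarith [hα.2])) (hnn.trans hlam)⟩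
end

section
/- Let Θ = [a, b] ⊂ ℝ be a compact interval, let L : Θ → ℝ be continuous with a unique maximizer θ̂ ∈ Θ (L(θ) < L(θ̂) for all θ ∈ Θ with θ ≠ θ̂), and let π : Θ → ℝ be continuous with π(θ) ≥ c for some c > 0 and all θ ∈ Θ. Then lim_{γ → ∞} (∫_Θ θ · exp(γ L(θ)) π(θ) dθ) / (∫_Θ exp(γ L(θ)) π(θ) dθ) = θ̂. -/
open Filter MeasureTheory

/-- The maximizer of a continuous criterion on a compact interval is the limit, as the
smoothing parameter `γ → ∞`, of the Quasi-posterior mean formed by exponentially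
transforming the criterion and weighting by a positive continuous prior
(the display following Corollary 3.1). -/
theorem quasi_posterior_mean_tendsto_argmax
    (a b : ℝ) (hab : a < b)
    (L : ℝ → ℝ) (hL : ContinuousOn L (Set.Icc a b))
    (θhat : ℝ) (hmem : θhat ∈ Set.Icc a b)
    (hmax : ∀ θ ∈ Set.Icc a b, θ ≠ θhat → L θ < L θhat)
    (w : ℝ → ℝ) (hwcont : ContinuousOn w (Set.Icc a b))
    (c : ℝ) (hc : 0 < c) (hw : ∀ θ ∈ Set.Icc a b, c ≤ w θ) :
    Tendsto
      (fun γ : ℝ =>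
        (∫ θ in Set.Icc a b, θ * Real.exp (γ * L θ) * w θ) /
        (∫ θ in Set.Icc a b, Real.exp (γ * L θ) * w θ))
      atTop (nhds θhat) := by
  have hs : IsCompact (Set.Icc a b) := isCompact_Icc
  have hcont : ∀ γ : ℝ, ContinuousOn (fun θ => Real.exp (γ * L θ) * w θ) (Set.Icc a b) :=
    fun γ => ((continuousOn_const.mul hL).rexp).mul hwcont
  have hint : ∀ γ : ℝ, IntegrableOn (fun θ => Real.exp (γ * L θ) * w θ) (Set.Icc a b) :=
    fun γ => (hcont γ).integrableOn_compact hs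
  have hnn : ∀ γ : ℝ, ∀ θ ∈ Set.Icc a b, 0 ≤ Real.exp (γ * L θ) * w θ :=
    fun γ θ hθ => mul_nonneg (Real.exp_pos _).le (hc.le.trans (hw θ hθ))
  set Z : ℝ → ℝ := fun γ => ∫ θ in Set.Icc a b, Real.exp (γ * L θ) * w θ with hZ
  -- lower bound for the normalizing constant
  have hlow : ∀ t' < L θhat, ∃ m : ℝ, 0 < m ∧ ∀ γ : ℝ, 0 ≤ γ → m * Real.exp (γ * t') ≤ Z γ := by
    intro t' ht'
    have h1 : {x | t' < L x} ∈ nhdsWithin θhat (Set.Icc a b) :=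
      (hL θhat hmem) (Ioi_mem_nhds ht')
    obtain ⟨u, hu, hθu, hus⟩ := mem_nhdsWithin.1 h1
    have hO : IsOpen (u ∩ Set.Ioo a b) := hu.inter isOpen_Ioo
    have hne : (u ∩ Set.Ioo a b).Nonempty := by
      have : θhat ∈ closure (Set.Ioo a b) := by rwa [closure_Ioo hab.ne]
      exact mem_closure_iff.1 this u hu hθu
    have hsub : u ∩ Set.Ioo a b ⊆ Set.Icc a b :=
      fun x hx => Set.Ioo_subset_Icc_self hx.2
    have hfin : volume (u ∩ Set.Ioo a b) ≠ ⊤ :=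
      ((measure_mono hsub).trans_lt hs.measure_lt_top).ne
    have hpos : 0 < volume.real (u ∩ Set.Ioo a b) :=
      ENNReal.toReal_pos (hO.measure_pos volume hne).ne' hfin
    refine ⟨volume.real (u ∩ Set.Ioo a b) * c, mul_pos hpos hc, fun γ hγ => ?_⟩
    calc volume.real (u ∩ Set.Ioo a b) * c * Real.exp (γ * t')
        = ∫ θ in u ∩ Set.Ioo a b, Real.exp (γ * t') * c := by
          rw [setIntegral_const, smul_eq_mul]; ring
      _ ≤ ∫ θ in u ∩ Set.Ioo a b, Real.exp (γ * L θ) * w θ := by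
          refine setIntegral_mono_on (integrableOn_const hfin) ((hint γ).mono_set hsub)
            hO.measurableSet fun x hx => ?_
          have h2 : t' < L x := hus ⟨hx.1, hsub hx⟩
          have h3 := hw x (hsub hx)
          gcongr
      _ ≤ Z γ := by
          refine setIntegral_mono_set (hint γ) ?_ (Eventually.of_forall hsub)
          exact (ae_restrict_iff' measurableSet_Icc).2 (Eventually.of_forall (hnn γ))
  have hZpos : ∀ γ : ℝ, 0 ≤ γ → 0 < Z γ := by
    intro γ hγ
    obtain ⟨m, hm, h⟩ := hlow (L θhat - 1) (by linarith)
    exact lt_of_lt_of_le (by positivity) (h γ hγ)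
  have key : Tendsto (fun γ : ℝ => ∫ θ in Set.Icc a b,
      (Real.exp (γ * L θ) * w θ / Z γ) • θ) atTop (nhds θhat) := by
    refine tendsto_setIntegral_peak_smul_of_integrableOn_of_tendsto
      (φ := fun γ θ => Real.exp (γ * L θ) * w θ / Z γ) (g := fun θ => θ) (x₀ := θhat)
      measurableSet_Icc measurableSet_Icc subset_rfl self_mem_nhdsWithin
      hs.measure_lt_top.ne ?_ ?_ ?_ ?_ (continuousOn_id.integrableOn_compact hs)
      (tendsto_id.mono_left nhdsWithin_le_nhds)
    · filter_upwards [eventually_ge_atTop 0] with γ hγ x hx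
      exact div_nonneg (hnn γ x hx) (hZpos γ hγ).le
    · intro u hu hθu
      have hK : IsCompact (Set.Icc a b \ u) := hs.diff hu
      obtain ⟨W, hW⟩ := hs.exists_bound_of_continuousOn hwcont
      obtain ⟨t, ht, htK⟩ : ∃ t < L θhat, ∀ x ∈ Set.Icc a b \ u, L x ≤ t := by
        rcases (Set.Icc a b \ u).eq_empty_or_nonempty with h | h
        · exact ⟨L θhat - 1, by linarith, by simp [h]⟩
        · obtain ⟨y, hy, hyK⟩ := hK.exists_isMaxOn h (hL.mono Set.sdiff_subset)
          exact ⟨L y, hmax y hy.1 (fun e => hy.2 (e ▸ hθu)), fun x hx => hyK hx⟩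
      obtain ⟨t', htt', ht'⟩ := exists_between ht
      obtain ⟨m, hm, hZl⟩ := hlow t' ht'
      have hlim : Tendsto (fun γ : ℝ => W / m * Real.exp (γ * (t - t'))) atTop (nhds 0) := by
        have : Tendsto (fun γ : ℝ => γ * (t - t')) atTop atBot :=
          tendsto_id.atTop_mul_const_of_neg (by linarith)
        simpa using (Real.tendsto_exp_atBot.comp this).const_mul (W / m)
      rw [Metric.tendstoUniformlyOn_iff]
      intro ε hε
      filter_upwards [eventually_ge_atTop 0, hlim.eventually (gt_mem_nhds hε)] with γ hγ hlt x hx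
      have hnn' := div_nonneg (hnn γ x hx.1) (hZpos γ hγ).le
      rw [Pi.zero_apply, dist_zero_left, Real.norm_of_nonneg hnn']
      refine lt_of_le_of_lt ?_ hlt
      have hwW : w x ≤ W := (le_abs_self _).trans (hW x hx.1)
      have hW0 : 0 ≤ W := (norm_nonneg _).trans (hW x hx.1)
      have hLt := htK x hx
      calc Real.exp (γ * L x) * w x / Z γ
          ≤ Real.exp (γ * t) * W / (m * Real.exp (γ * t')) := by
            have := hZl γ hγ
            have hw0 : 0 ≤ w x := hc.le.trans (hw x hx.1)
            gcongr
        _ = W / m * Real.exp (γ * (t - t')) := by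
            rw [mul_sub, Real.exp_sub]
            field_simp
    · refine tendsto_const_nhds.congr' ?_
      filter_upwards [eventually_ge_atTop 0] with γ hγ
      rw [integral_div]
      exact (div_self (hZpos γ hγ).ne').symm
    · exact Eventually.of_forall fun γ =>
        (((hcont γ).div_const _).aestronglyMeasurable measurableSet_Icc)
  refine key.congr fun γ => ?_
  rw [← integral_div]
  congr 1
  ext θ
  simp only [smul_eq_mul]
  ring
end
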